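/- For every negative log-likelihood of a single sample with legal ground-truth path y: -log L(l, Ā(A₀, c)) → -log L'(l, A₀) as c → -∞, where both quantities are well defined since all summands in the denominators are positive and the legal-path sum is nonempty (it contains y). -/

import Mathlib

open Finset Filter Topology

/-- The score of a path `p` given emission logits `l` and transition matrix `A`:
the sum of emission scores plus the sum of transition scores over consecutive pairs. -/
def score {n d : ℕ} (l : Fin (n + 1) → Fin d → ℝ) (A : Fin d → Fin d → ℝ)
    (p : Fin (n + 1) → Fin d) : ℝ :=
  (∑ i, l i (p i)) + ∑ i : Fin n, A (p i.castSucc) (p i.succ)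

/-- The masked transition matrix: entries in the illegal set `Ω` are replaced by `c`. -/
def masked {d : ℕ} (Ω : Finset (Fin d × Fin d)) (A : Fin d → Fin d → ℝ) (c : ℝ) :
    Fin d → Fin d → ℝ :=
  fun i j => if (i, j) ∈ Ω then c else A i j

/-- A path is legal if it contains no illegal transition. -/
def Legal {n d : ℕ} (Ω : Finset (Fin d × Fin d)) (p : Fin (n + 1) → Fin d) : Prop :=
  ∀ i : Fin n, (p i.castSucc, p i.succ) ∉ Ω

instance {n d : ℕ} (Ω : Finset (Fin d × Fin d)) : DecidablePred (Legal (n := n) Ω) :=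
  fun _ => by unfold Legal; infer_instance

/-- Partition function: sum of exponentiated scores over all paths. -/
noncomputable def partAll {n d : ℕ} (l : Fin (n + 1) → Fin d → ℝ)
    (A : Fin d → Fin d → ℝ) : ℝ :=
  ∑ p : Fin (n + 1) → Fin d, Real.exp (score l A p)

/-- Restricted partition function: sum of exponentiated scores over legal paths. -/
noncomputable def partLegal {n d : ℕ} (Ω : Finset (Fin d × Fin d))
    (l : Fin (n + 1) → Fin d → ℝ) (A : Fin d → Fin d → ℝ) : ℝ :=
  ∑ p ∈ Finset.univ.filter (Legal Ω), Real.exp (score l A p)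

/-- The CRF likelihood of a ground-truth path `y`. -/
noncomputable def Lik {n d : ℕ} (y : Fin (n + 1) → Fin d) (l : Fin (n + 1) → Fin d → ℝ)
    (A : Fin d → Fin d → ℝ) : ℝ :=
  Real.exp (score l A y) / partAll l A

/-- The masked-CRF likelihood of a ground-truth path `y`. -/
noncomputable def LikM {n d : ℕ} (Ω : Finset (Fin d × Fin d)) (y : Fin (n + 1) → Fin d)
    (l : Fin (n + 1) → Fin d → ℝ) (A : Fin d → Fin d → ℝ) : ℝ :=
  Real.exp (score l A y) / partLegal Ω l A

/-- The CRF loss over a family of `N` training samples. -/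
noncomputable def crfLoss {n d : ℕ} (N : ℕ) (l : Fin N → Fin (n + 1) → Fin d → ℝ)
    (y : Fin N → Fin (n + 1) → Fin d) (A : Fin d → Fin d → ℝ) : ℝ :=
  -(1 / (N : ℝ)) * ∑ k, Real.log (Lik (y k) (l k) A)

/-- The masked-CRF loss over a family of `N` training samples. -/
noncomputable def mcrfLoss {n d : ℕ} (Ω : Finset (Fin d × Fin d)) (N : ℕ)
    (l : Fin N → Fin (n + 1) → Fin d → ℝ) (y : Fin N → Fin (n + 1) → Fin d)
    (A : Fin d → Fin d → ℝ) : ℝ :=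
  -(1 / (N : ℝ)) * ∑ k, Real.log (LikM Ω (y k) (l k) A)

/-- Masking does not change the score of a legal path. -/
lemma score_masked_of_legal {n d : ℕ} {Ω : Finset (Fin d × Fin d)} {p : Fin (n + 1) → Fin d}
    (hp : Legal Ω p) (l : Fin (n + 1) → Fin d → ℝ) (A : Fin d → Fin d → ℝ) (c : ℝ) :
    score l (masked Ω A c) p = score l A p := by
  unfold score masked
  congr 1
  exact Finset.sum_congr rfl fun i _ => if_neg (hp i)

/-- The score of an illegal path tends to `-∞` with the mask value. -/
lemma tendsto_score_masked_atBot {n d : ℕ} {Ω : Finset (Fin d × Fin d)}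
    {p : Fin (n + 1) → Fin d} (hp : ¬ Legal Ω p)
    (l : Fin (n + 1) → Fin d → ℝ) (A : Fin d → Fin d → ℝ) :
    Tendsto (fun c : ℝ => score l (masked Ω A c) p) atBot atBot := by
  obtain ⟨i, hi⟩ : ∃ i : Fin n, (p i.castSucc, p i.succ) ∈ Ω := by
    simpa [Legal] using hp
  simp only [score, masked, Finset.sum_ite, Finset.sum_const, nsmul_eq_mul]
  refine tendsto_atBot_add_const_left _ _ (tendsto_atBot_add_const_right _ _ ?_)
  refine tendsto_id.const_mul_atBot (Nat.cast_pos.2 (Finset.card_pos.2 ⟨i, ?_⟩))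
  simpa using hi

/-- The partition function of the masked matrix tends to the sum over legal paths. -/
lemma tendsto_partAll_masked {n d : ℕ} (Ω : Finset (Fin d × Fin d))
    (l : Fin (n + 1) → Fin d → ℝ) (A : Fin d → Fin d → ℝ) :
    Tendsto (fun c : ℝ => partAll l (masked Ω A c)) atBot (𝓝 (partLegal Ω l A)) := by
  unfold partAll partLegal
  rw [Finset.sum_filter]
  refine tendsto_finsetSum _ fun p _ => ?_
  split_ifs with hp
  · simp only [score_masked_of_legal hp, tendsto_const_nhds]
  · exact Real.tendsto_exp_atBot.comp (tendsto_score_masked_atBot hp l A)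

/-- The sum over legal paths is positive as soon as there is a legal path. -/
lemma partLegal_pos {n d : ℕ} {Ω : Finset (Fin d × Fin d)} {y : Fin (n + 1) → Fin d}
    (hy : Legal Ω y) (l : Fin (n + 1) → Fin d → ℝ) (A : Fin d → Fin d → ℝ) :
    0 < partLegal Ω l A :=
  Finset.sum_pos (fun _ _ => Real.exp_pos _) ⟨y, by simpa using hy⟩

/-- for a legal ground-truth path `y`,
`-log L(l, Ā(A₀, c)) → -log L'(l, A₀)` as `c → -∞`. -/
theorem stmt_15 {n d : ℕ} (hd : 1 ≤ d) (Ω : Finset (Fin d × Fin d))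
    (y : Fin (n + 1) → Fin d) (hy : Legal Ω y)
    (l : Fin (n + 1) → Fin d → ℝ) (A₀ : Fin d → Fin d → ℝ) :
    Tendsto (fun c : ℝ => -Real.log (Lik y l (masked Ω A₀ c))) atBot
      (𝓝 (-Real.log (LikM Ω y l A₀))) := by
  have hpos := partLegal_pos hy l A₀
  simp only [Lik, LikM, score_masked_of_legal hy]
  exact ((tendsto_const_nhds.div (tendsto_partAll_masked Ω l A₀) hpos.ne').log
    (div_pos (Real.exp_pos _) hpos).ne').neg
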